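/- Let f ≥ 2 be an integer. For every integer l ≥ 1 there exists a left ideal I′ ⊆ M_f(R) such that the quotient M_f(R)/I′ has finite length f·l as an R-module and I′ is not a two-sided ideal of M_f(R). -/

import Mathlib

/-!
STATEMENT 1: For `f ≥ 2` and every `l ≥ 1` there is a left ideal `I' ⊆ M_f(R)` such that
`M_f(R)/I'` has finite length `f·l` as an `R`-module and `I'` is not a two-sided ideal.
Here `R = ℂ[[u,v]]`.
-/

noncomputable section

/-- `R = ℂ[[u,v]]`, the ring of formal power series in two variables over `ℂ`. -/
abbrev R : Type := MvPowerSeries (Fin 2) ℂ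

/-- `M` has finite length `l` as an `R₀`-module, expressed by the existence of a
composition series from `⊥` to `⊤` of length `l`. -/
def lengthEq (R₀ M : Type) [Ring R₀] [AddCommGroup M] [Module R₀ M] (l : ℕ) : Prop :=
  ∃ s : CompositionSeries (Submodule R₀ M), s.head = ⊥ ∧ s.last = ⊤ ∧ s.length = l

/-- A module of length `l` has a composition series of length `l`. -/
lemma lengthEq_of_length_eq {R₀ M : Type} [Ring R₀] [AddCommGroup M] [Module R₀ M] {l : ℕ}
    (h : Module.length R₀ M = l) : lengthEq R₀ M l := by
  have hfin : IsFiniteLength R₀ M := Module.length_ne_top_iff.mp (by simp [h])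
  obtain ⟨s, hs, hs'⟩ := isFiniteLength_iff_exists_compositionSeries.mp hfin
  refine ⟨s, hs, hs', ?_⟩
  have := Module.length_compositionSeries s hs hs'
  rw [h] at this
  exact_mod_cast this

lemma length_quotient_eq_add_one_of_covBy {A M : Type*} [Ring A] [AddCommGroup M] [Module A M]
    {P Q : Submodule A M} (h : P ⋖ Q) :
    Module.length A (M ⧸ P) = Module.length A (M ⧸ Q) + 1 := by
  have hsimple : IsSimpleModule A (Q ⧸ P.comap Q.subtype) :=
    (covBy_iff_quot_is_simple h.le).mp h
  rw [Module.length_eq_add_of_exact ((P.comap Q.subtype).mapQ P Q.subtype le_rfl)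
    (Submodule.factor h.le) ?_ (Submodule.factor_surjective h.le) ?_,
    Module.length_eq_one_iff.mpr hsimple, add_comm]
  · rw [← LinearMap.ker_eq_bot, Submodule.mapQ, Submodule.ker_liftQ_eq_bot]
    simp [LinearMap.ker_comp]
  · intro x
    obtain ⟨x, rfl⟩ := P.mkQ_surjective x
    constructor
    · intro hx
      have hx : x ∈ Q := (Submodule.Quotient.mk_eq_zero Q).mp hx
      exact ⟨Submodule.Quotient.mk ⟨x, hx⟩, rfl⟩
    · rintro ⟨y, hy⟩
      obtain ⟨y, rfl⟩ := Submodule.mkQ_surjective _ y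
      rw [← hy]
      exact (Submodule.Quotient.mk_eq_zero Q).mpr y.2

/-- The ideal of power series `p` such that `p(u, 0)` is divisible by `u ^ k`. -/
def axisIdeal (k : ℕ) : Ideal R where
  carrier := {p | ∀ i < k, MvPowerSeries.coeff (Finsupp.single 0 i) p = 0}
  zero_mem' := by simp
  add_mem' hp hq i hi := by rw [map_add, hp i hi, hq i hi, add_zero]
  smul_mem' a p hp i hi := by
    classical
    rw [smul_eq_mul, MvPowerSeries.coeff_mul]
    refine Finset.sum_eq_zero fun x hx => ?_
    rw [Finsupp.antidiagonal_single] at hx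
    obtain ⟨⟨m, n⟩, hmn, rfl⟩ := Finset.mem_map.mp hx
    have hn : n < k := by
      have := Finset.HasAntidiagonal.mem_antidiagonal.mp hmn
      dsimp at this
      omega
    exact mul_eq_zero_of_right _ (hp n hn)

lemma mem_axisIdeal {k : ℕ} {p : R} :
    p ∈ axisIdeal k ↔ ∀ i < k, MvPowerSeries.coeff (Finsupp.single 0 i) p = 0 :=
  Iff.rfl

lemma axisIdeal_succ_covBy (k : ℕ) : axisIdeal (k + 1) ⋖ axisIdeal k := by
  classical
  have hle : axisIdeal (k + 1) ≤ axisIdeal k := fun p hp i hi => hp i (by omega)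
  refine ⟨lt_of_le_not_ge hle fun hge => ?_, fun N hN hN' => ?_⟩
  · have hmem : (MvPowerSeries.monomial (Finsupp.single 0 k) 1 : R) ∈ axisIdeal k := by
      intro i hi
      rw [MvPowerSeries.coeff_monomial, if_neg]
      intro heq
      have := Finsupp.single_injective 0 heq
      omega
    have := hge hmem k (by omega)
    simp at this
  · obtain ⟨g, hgN, hg⟩ := SetLike.exists_of_lt hN
    have hgk := hN'.le hgN
    have hc : MvPowerSeries.coeff (Finsupp.single 0 k) g ≠ 0 := by
      intro h0
      refine hg fun i hi => ?_
      rcases Nat.lt_succ_iff_lt_or_eq.mp hi with hi | rfl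
      · exact hgk i hi
      · exact h0
    refine hN'.not_ge fun p hp => ?_
    set c := MvPowerSeries.coeff (Finsupp.single 0 k) p / MvPowerSeries.coeff (Finsupp.single 0 k) g
    have hdiff : p - MvPowerSeries.C c * g ∈ axisIdeal (k + 1) := by
      intro i hi
      rw [map_sub, MvPowerSeries.coeff_C_mul]
      rcases Nat.lt_succ_iff_lt_or_eq.mp hi with hi | rfl
      · rw [hp i hi, hgk i hi, mul_zero, sub_zero]
      · rw [div_mul_cancel₀ _ hc, sub_self]
    simpa using N.add_mem (hN.le hdiff) (N.mul_mem_left (MvPowerSeries.C c) hgN)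

lemma length_quotient_axisIdeal (k : ℕ) : Module.length R (R ⧸ axisIdeal k) = k := by
  induction k with
  | zero =>
    have : axisIdeal 0 = ⊤ := by
      ext p
      simp [mem_axisIdeal]
    rw [Nat.cast_zero, Module.length_eq_zero_iff, this]
    infer_instance
  | succ k ih =>
    rw [length_quotient_eq_add_one_of_covBy (axisIdeal_succ_covBy k), ih, Nat.cast_succ]

/-- The left ideal of square matrices whose `j`-th column has entries in `J`. -/
def columnLeftIdeal {A n : Type*} [CommRing A] [Fintype n] [DecidableEq n] (J : Ideal A) (j : n) :
    Submodule (Matrix n n A) (Matrix n n A) where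
  carrier := {x | ∀ i, x i j ∈ J}
  zero_mem' _ := J.zero_mem
  add_mem' hx hy i := J.add_mem (hx i) (hy i)
  smul_mem' a x hx i := by
    rw [smul_eq_mul, Matrix.mul_apply]
    exact J.sum_mem fun m _ => J.mul_mem_left _ (hx m)

lemma length_quotient_columnLeftIdeal {A n : Type*} [CommRing A] [Fintype n] [DecidableEq n]
    (J : Ideal A) (j : n) :
    Module.length A (Matrix n n A ⧸ columnLeftIdeal J j) =
      Fintype.card n * Module.length A (A ⧸ J) := by
  let φ : Matrix n n A →ₗ[A] (n → A ⧸ J) :=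
    LinearMap.pi fun i => J.mkQ ∘ₗ Matrix.entryLinearMap A A i j
  have hker : (columnLeftIdeal J j).restrictScalars A = LinearMap.ker φ := by
    ext x
    simp only [LinearMap.mem_ker, funext_iff]
    exact forall_congr' fun i => (Submodule.Quotient.mk_eq_zero J).symm
  have hsurj : Function.Surjective φ := by
    intro y
    choose z hz using fun i => J.mkQ_surjective (y i)
    exact ⟨Matrix.of fun i _ => z i, funext hz⟩
  rw [((Submodule.Quotient.restrictScalarsEquiv A (columnLeftIdeal J j)).symm ≪≫ₗ
    Submodule.quotEquivOfEq _ _ hker ≪≫ₗ φ.quotKerEquivOfSurjective hsurj).length_eq,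
    Module.length_pi_of_fintype]
  simp

lemma columnLeftIdeal_not_twoSided {A n : Type*} [CommRing A] [Fintype n] [DecidableEq n]
    {J : Ideal A} (hJ : J ≠ ⊤) {j k : n} (hjk : j ≠ k) :
    ¬ (∀ x ∈ columnLeftIdeal J j, ∀ a : Matrix n n A, x * a ∈ columnLeftIdeal J j) := by
  intro h
  have hmem : Matrix.single j k (1 : A) ∈ columnLeftIdeal J j := by
    intro i
    rw [Matrix.single_apply_of_col_ne j i hjk.symm]
    exact J.zero_mem
  have := h _ hmem (Matrix.single k j 1) j
  rw [Matrix.single_mul_single_same, Matrix.single_apply_same, mul_one] at this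
  exact hJ ((Ideal.eq_top_iff_one J).mpr this)

theorem exists_left_ideal_not_twoSided (f : ℕ) (hf : 2 ≤ f) (l : ℕ) (hl : 1 ≤ l) :
    ∃ I' : Submodule (Matrix (Fin f) (Fin f) R) (Matrix (Fin f) (Fin f) R),
      lengthEq R (Matrix (Fin f) (Fin f) R ⧸ I') (f * l) ∧
      ¬ (∀ x ∈ I', ∀ a : Matrix (Fin f) (Fin f) R, x * a ∈ I') := by
  refine ⟨columnLeftIdeal (axisIdeal l) ⟨0, by omega⟩, lengthEq_of_length_eq ?_,
    columnLeftIdeal_not_twoSided (fun htop => ?_) (k := ⟨1, by omega⟩) (by simp)⟩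
  · rw [length_quotient_columnLeftIdeal, length_quotient_axisIdeal, Fintype.card_fin, Nat.cast_mul]
  · have := (Ideal.eq_top_iff_one _).mp htop 0 hl
    simp at this

end
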